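/- Let s > 2. The maximal size of a partition that is simultaneously an (s−1)-core, an s-core, and an (s+1)-core is k·C(k+1,3) if s = 2k is even, and (k+1)·C(k+1,3) + C(k+2,3) if s = 2k+1 is odd, where C(n,3) denotes the binomial coefficient. -/

import Mathlib

/-- A partition: a weakly decreasing sequence of natural numbers (indexed from 0)
that is eventually zero.  `parts i` is the (i+1)-st largest part (0 if `i` exceeds
the number of parts). -/
structure NPartition where
  parts : ℕ → ℕ
  antitone : ∀ ⦃i j : ℕ⦄, i ≤ j → parts j ≤ parts i
  eventually_zero : ∃ N, ∀ i, N ≤ i → parts i = 0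

namespace NPartition

/-- The size of a partition: the sum of its parts. -/
noncomputable def size (lam : NPartition) : ℕ := ∑ᶠ i, lam.parts i

/-- The number of (positive) parts of a partition. -/
noncomputable def numParts (lam : NPartition) : ℕ := sInf {N | lam.parts N = 0}

/-- The conjugate partition: `conj.parts j` is the number of rows whose part exceeds `j`,
i.e. the length of column `j` of the Young diagram. -/
noncomputable def conj (lam : NPartition) : NPartition where
  parts := fun j => ((Finset.range lam.numParts).filter (fun i => j < lam.parts i)).card
  antitone := by
    intro a b hab
    apply Finset.card_le_card
    intro x hx
    simp only [Finset.mem_filter] at hx ⊢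
    exact ⟨hx.1, lt_of_le_of_lt hab hx.2⟩
  eventually_zero := by
    refine ⟨lam.parts 0, fun j hj => ?_⟩
    simp only [Finset.card_eq_zero, Finset.filter_eq_empty_iff]
    intro i _
    exact not_lt.mpr (le_trans (lam.antitone (Nat.zero_le i)) hj)

/-- The hook length of the box in row `i`, column `j` (both 0-indexed) of the Young
diagram: arm + leg + 1. -/
noncomputable def hookLength (lam : NPartition) (i j : ℕ) : ℕ :=
  (lam.parts i - (j + 1)) + (lam.conj.parts j - (i + 1)) + 1

/-- `lam` is an `s`-core: no box of its Young diagram has hook length `s`. -/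
noncomputable def IsCore (s : ℕ) (lam : NPartition) : Prop :=
  ∀ i j, j < lam.parts i → lam.hookLength i j ≠ s

/-- The empty partition. -/
def emptyP : NPartition := ⟨fun _ => 0, fun _ _ _ => le_rfl, ⟨0, fun _ _ => rfl⟩⟩

/-- The parts of the partition obtained from `lam` by removing the (rim) hook with
corner box `(i, j)` (0-indexed). -/
noncomputable def removeHookParts (lam : NPartition) (i j : ℕ) : ℕ → ℕ := fun r =>
  if r < i then lam.parts r
  else if r + 1 < lam.conj.parts j then lam.parts (r + 1) - 1
  else if r + 1 = lam.conj.parts j then j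
  else lam.parts r

/-- `mu` is obtained from `lam` by removing a single hook of length `s`. -/
noncomputable def RemoveHookStep (s : ℕ) (lam mu : NPartition) : Prop :=
  ∃ i j, j < lam.parts i ∧ lam.hookLength i j = s ∧
    ∀ r, mu.parts r = lam.removeHookParts i j r

/-- `core` is the `s`-core of `lam`: it is obtained from `lam` by repeatedly removing
hooks of length `s`, and no hook of length `s` remains. -/
noncomputable def HasSCore (s : ℕ) (lam core : NPartition) : Prop :=
  Relation.ReflTransGen (RemoveHookStep s) lam core ∧ IsCore s core

/-- The bead-set of `lam` with shift `k`: the set `{0, …, k-1} ∪ {h + k : h a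
first-column hook length of `lam`}`.  (The first-column hook length of row `i`
(0-indexed) is `parts i + (m - (i+1))` where `m` is the number of parts.) -/
noncomputable def beadSet (lam : NPartition) (k : ℕ) : Finset ℕ :=
  Finset.range k ∪ (Finset.range lam.numParts).image
    (fun i => lam.parts i + (lam.numParts - (i + 1)) + k)

/-- `X` is a bead-set for `lam`. -/
noncomputable def IsBeadSet (lam : NPartition) (X : Finset ℕ) : Prop :=
  ∃ k, X = lam.beadSet k

/-- The minimal bead-set of `lam` (shift `k = 0`), i.e. its set of first-column
hook lengths. -/
noncomputable def minBeadSet (lam : NPartition) : Finset ℕ := lam.beadSet 0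

/-- `X` is the bead-set of `lam` normalized with respect to `s`: the size of `X`
is divisible by `s`, with the least possible shift `k`. -/
noncomputable def IsNormalizedBeadSet (s : ℕ) (lam : NPartition) (X : Finset ℕ) : Prop :=
  ∃ k, X = lam.beadSet k ∧ (lam.beadSet k).card % s = 0 ∧
    ∀ k' < k, (lam.beadSet k').card % s ≠ 0

end NPartition

/-- Runner `i` of the `s`-abacus of the bead-set `X`:  `X_i = {j : i + j·s ∈ X}`. -/
def runner (s i : ℕ) (X : Finset ℕ) : Finset ℕ :=
  (Finset.range (X.sup id + 1)).filter (fun j => i + j * s ∈ X)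

/-- The staircase partition `τ_ℓ = (ℓ, ℓ-1, …, 1)`. -/
def staircase (l : ℕ) : NPartition :=
  ⟨fun i => l - i, fun _ _ hij => Nat.sub_le_sub_left hij l,
   ⟨l, fun i hi => Nat.sub_eq_zero_of_le hi⟩⟩

/-- `P_{s,t}`: the set of positive integers not expressible as a nonnegative integer
combination of `s` and `t`. -/
def Pst (s t : ℕ) : Set ℕ := {n | 0 < n ∧ ¬ ∃ a b : ℕ, n = a * s + b * t}


section TripleCore

open Finset in
theorem ivt_up (h : ℕ → ℕ) (s : ℕ) (hup : ∀ r, r + 1 < s → h (r + 1) ≤ h r + 1)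
    (i j u : ℕ) (hij : i ≤ j) (hj : j < s) (hi : h i ≤ u) (hu : u ≤ h j) :
    ∃ c, i ≤ c ∧ c ≤ j ∧ h c = u := by
  induction j, hij using Nat.le_induction with
  | base => exact ⟨i, le_rfl, le_rfl, by omega⟩
  | succ n hn ih =>
    by_cases hc : u ≤ h n
    · obtain ⟨c, h1, h2, h3⟩ := ih (by omega) hc
      exact ⟨c, h1, by omega, h3⟩
    · have := hup n hj
      exact ⟨n + 1, by omega, le_rfl, by omega⟩

theorem ivt_down (h : ℕ → ℕ) (s : ℕ) (hdn : ∀ r, r + 1 < s → h r ≤ h (r + 1) + 1)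
    (i j u : ℕ) (hij : i ≤ j) (hj : j < s) (hi : u ≤ h i) (hu : h j ≤ u) :
    ∃ c, i ≤ c ∧ c ≤ j ∧ h c = u := by
  induction j, hij using Nat.le_induction with
  | base => exact ⟨i, le_rfl, le_rfl, by omega⟩
  | succ n hn ih =>
    by_cases hc : h n ≤ u
    · obtain ⟨c, h1, h2, h3⟩ := ih (by omega) hc
      exact ⟨c, h1, by omega, h3⟩
    · have := hdn n hj
      exact ⟨n + 1, by omega, le_rfl, by omega⟩

/-- The sequence of runner heights is a Motzkin path. -/
structure Motz (s : ℕ) (h : ℕ → ℕ) : Prop where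
  zero : h 0 = 0
  last : h (s - 1) = 0
  up : ∀ r, r + 1 < s → h (r + 1) ≤ h r + 1
  dn : ∀ r, r + 1 < s → h r ≤ h (r + 1) + 1

theorem Motz.le_left {s : ℕ} {h : ℕ → ℕ} (H : Motz s h) (r : ℕ) (hr : r < s) : h r ≤ r := by
  induction r with
  | zero => simp [H.zero]
  | succ n ih => have := H.up n hr; have := ih (by omega); omega

theorem Motz.le_right {s : ℕ} {h : ℕ → ℕ} (H : Motz s h) (d : ℕ) (hr : d < s) :
    h (s - 1 - d) ≤ d := by
  induction d with
  | zero => simp [H.last]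
  | succ n ih =>
    have := H.dn (s - 1 - (n + 1)) (by omega)
    rw [show s - 1 - (n + 1) + 1 = s - 1 - n by omega] at this
    have := ih (by omega); omega

theorem Motz.two_mul_le {s : ℕ} {h : ℕ → ℕ} (H : Motz s h) (r : ℕ) (hr : r < s) :
    2 * h r + 1 ≤ s := by
  have h1 := H.le_left r hr
  have h2 := H.le_right (s - 1 - r) (by omega)
  rw [show s - 1 - (s - 1 - r) = r by omega] at h2
  omega

/-- first gap on runner `r` -/
def zz (s : ℕ) (h : ℕ → ℕ) (r : ℕ) : ℕ := s * h r + r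

theorem zz_lt_iff {s : ℕ} {h : ℕ → ℕ} (p a b : ℕ) (ha : a < s) (hb : b < s) :
    zz s h a + p * s < zz s h b ↔ (h a + p < h b ∨ (h a + p = h b ∧ a < b)) := by
  unfold zz
  constructor
  · intro hlt
    by_contra hcon
    push Not at hcon
    obtain ⟨h1, h2⟩ := hcon
    rcases Nat.lt_or_ge (h b) (h a + p) with h3 | h3
    · have := Nat.mul_le_mul_left s (show h b + 1 ≤ h a + p from h3)
      nlinarith
    · have h4 : h a + p = h b := by omega
      have := h2 h4
      have h5 : s * h b = s * h a + p * s := by rw [← h4]; ring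
      omega
  · rintro (h1 | ⟨h1, h2⟩)
    · have := Nat.mul_le_mul_left s (show h a + p + 1 ≤ h b from h1)
      nlinarith
    · have h5 : s * h b = s * h a + p * s := by rw [← h1]; ring
      omega

theorem zz_inj {s : ℕ} {h : ℕ → ℕ} (a b : ℕ) (ha : a < s) (hb : b < s)
    (hab : zz s h a = zz s h b) : a = b := by
  have h1 := zz_lt_iff (h := h) 0 a b ha hb
  have h2 := zz_lt_iff (h := h) 0 b a hb ha
  simp [hab] at h1 h2
  omega

open Finset

/-- rows above -/
def cA (s : ℕ) (h : ℕ → ℕ) (p a : ℕ) : Finset ℕ :=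
  (range s).filter (fun b => zz s h a + p * s < zz s h b)
def cB (s : ℕ) (h : ℕ → ℕ) (p a : ℕ) : Finset ℕ :=
  (range s).filter (fun b => zz s h a < zz s h b ∧ zz s h b < zz s h a + p * s)
def cR (s : ℕ) (h : ℕ → ℕ) (a : ℕ) : Finset ℕ :=
  (range s).filter (fun b => zz s h b < zz s h a)
def cL (s : ℕ) (h : ℕ → ℕ) (a : ℕ) : Finset ℕ :=
  (range s).filter (fun c => a < c ∧ h c = h a)

theorem card_total (s : ℕ) (h : ℕ → ℕ) (p a : ℕ) (ha : a < s) :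
    (cA s h p a).card + (cB s h p a).card + (cR s h a).card + 1 ≤ s := by
  have d1 : Disjoint (cA s h p a) (cB s h p a) := by
    rw [Finset.disjoint_left]; intro x; simp only [cA, cB, mem_filter]; omega
  have d2 : Disjoint (cA s h p a ∪ cB s h p a) (cR s h a) := by
    rw [Finset.disjoint_left]; intro x; simp only [cA, cB, cR, mem_filter, mem_union]
    have := Nat.zero_le (p * s); omega
  have d3 : Disjoint ((cA s h p a ∪ cB s h p a) ∪ cR s h a) {a} := by
    rw [Finset.disjoint_left]; intro x
    simp only [cA, cB, cR, mem_filter, mem_union, mem_singleton]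
    rintro hx rfl
    have := Nat.zero_le (p * s); omega
  have : ((cA s h p a ∪ cB s h p a) ∪ cR s h a) ∪ {a} ⊆ range s := by
    intro x; simp only [cA, cB, cR, mem_filter, mem_union, mem_singleton, mem_range]; omega
  have := card_le_card this
  rw [card_union_of_disjoint d3, card_union_of_disjoint d2, card_union_of_disjoint d1] at this
  simpa using this

theorem key {s : ℕ} {h : ℕ → ℕ} (H : Motz s h) (p a : ℕ) (hp : 1 ≤ p) (ha : a < s)
    (hA : (cA s h p a).Nonempty) :
    2 * p - 1 ≤ (cB s h p a).card ∧
      ((cB s h p a).card ≤ 2 * p - 1 → (cL s h a).card = 1) := by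
  obtain ⟨b, hb⟩ := hA
  simp only [cA, mem_filter, mem_range] at hb
  obtain ⟨hbs, hb⟩ := hb
  rw [zz_lt_iff p a b ha hbs] at hb
  set v := h a with hv
  set M1 := (range s).filter (fun c => c < b ∧ v < h c ∧ h c < v + p) with hM1
  set M2 := (range s).filter (fun c => b < c ∧ v < h c ∧ h c < v + p) with hM2
  set U := (range s).filter (fun c => c < a ∧ h c = v + p) with hU
  have cM1 : p - 1 ≤ M1.card := by
    have : Ioo v (v + p) ⊆ M1.image h := by
      intro u hu
      simp only [mem_Ioo] at hu
      obtain ⟨c, h1, h2, h3⟩ := ivt_up h s H.up 0 b u (by omega) hbs (by rw [H.zero]; omega) (by omega)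
      simp only [hM1, mem_image, mem_filter, mem_range]
      refine ⟨c, ⟨by omega, ?_, by omega⟩, h3⟩
      rcases Nat.lt_or_ge c b with h | h
      · exact h
      · have : c = b := by omega
        subst this; omega
    have := (card_le_card this).trans card_image_le
    simp at this; omega
  have cM2 : p - 1 ≤ M2.card := by
    have : Ioo v (v + p) ⊆ M2.image h := by
      intro u hu
      simp only [mem_Ioo] at hu
      obtain ⟨c, h1, h2, h3⟩ := ivt_down h s H.dn b (s - 1) u (by omega) (by omega) (by omega)
        (by rw [H.last]; omega)
      simp only [hM2, mem_image, mem_filter, mem_range]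
      refine ⟨c, ⟨by omega, ?_, by omega⟩, h3⟩
      rcases Nat.lt_or_ge b c with h | h
      · exact h
      · have : c = b := by omega
        subst this; omega
    have := (card_le_card this).trans card_image_le
    simp at this; omega
  have d1 : Disjoint M1 M2 := by
    rw [Finset.disjoint_left]; intro x; simp only [hM1, hM2, mem_filter]; omega
  have d2 : Disjoint (M1 ∪ M2) (cL s h a) := by
    rw [Finset.disjoint_left]; intro x; simp only [hM1, hM2, cL, mem_union, mem_filter]; omega
  have d3 : Disjoint ((M1 ∪ M2) ∪ cL s h a) U := by
    rw [Finset.disjoint_left]; intro x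
    simp only [hM1, hM2, hU, cL, mem_union, mem_filter]; omega
  have hsub : ((M1 ∪ M2) ∪ cL s h a) ∪ U ⊆ cB s h p a := by
    intro c hc
    have hcs : c < s := by
      simp only [hM1, hM2, hU, cL, mem_union, mem_filter, mem_range] at hc; omega
    have e1 := zz_lt_iff (h := h) 0 a c ha hcs
    have e2 := zz_lt_iff (h := h) p a c ha hcs
    have e3 : zz s h c ≠ zz s h a + p * s := by
      intro heq
      unfold zz at heq
      have : c = a := by
        have h1 : (s * h c + c) % s = c := by
          rw [Nat.mul_add_mod, Nat.mod_eq_of_lt hcs]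
        have h2 : (s * h a + a + p * s) % s = a := by
          rw [Nat.add_mul_mod_self_right, Nat.mul_add_mod, Nat.mod_eq_of_lt ha]
        rw [← h1, heq, h2]
      simp only [hM1, hM2, hU, cL, mem_union, mem_filter, mem_range] at hc
      subst this; omega
    simp only [hM1, hM2, hU, cL, mem_union, mem_filter, mem_range] at hc
    simp only [cB, mem_filter, mem_range]
    simp only [zero_mul, add_zero] at e1
    refine ⟨hcs, e1.2 (by omega), ?_⟩
    by_contra hcon
    have := e2.1 (by omega)
    omega
  have hcard := card_le_card hsub
  rw [card_union_of_disjoint d3, card_union_of_disjoint d2, card_union_of_disjoint d1] at hcard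
  have hcase : 1 ≤ (cL s h a).card ∨ 2 ≤ U.card := by
    rcases Nat.lt_trichotomy a b with hab | hab | hab
    · left
      obtain ⟨c, h1, h2, h3⟩ := ivt_down h s H.dn b (s - 1) v (by omega) (by omega) (by omega)
        (by rw [H.last]; omega)
      apply card_pos.2
      exact ⟨c, by simp only [cL, mem_filter, mem_range]; omega⟩
    · subst hab; omega
    · right
      obtain ⟨c, h1, h2, h3⟩ := ivt_up h s H.up 0 b (v + p) (by omega) hbs
        (by rw [H.zero]; omega) (by omega)
      obtain ⟨c', h1', h2', h3'⟩ := ivt_down h s H.dn b a (v + p) (by omega) (by omega) (by omega)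
        (by omega)
      have n1 : c ≠ b := by rintro rfl; omega
      have n2 : c' ≠ b := by rintro rfl; omega
      have n3 : c' ≠ a := by rintro rfl; omega
      apply Finset.one_lt_card.2
      refine ⟨c, ?_, c', ?_, by omega⟩
      · simp only [hU, mem_filter, mem_range]; omega
      · simp only [hU, mem_filter, mem_range]; omega
  constructor <;> omega

theorem rank_sum (s : ℕ) (h : ℕ → ℕ) (f : ℕ → ℕ) :
    ∑ a ∈ range s, f (cR s h a).card = ∑ i ∈ range s, f i := by
  have hinj : Set.InjOn (fun a => (cR s h a).card) (range s : Set ℕ) := by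
    have key : ∀ a b, a < s → b < s → zz s h a < zz s h b →
        (cR s h a).card < (cR s h b).card := by
      intro a b ha hb hab
      apply card_lt_card
      rw [Finset.ssubset_iff_of_subset]
      · exact ⟨a, by simp [cR, ha, hab], by simp [cR]⟩
      · intro x; simp only [cR, mem_filter]
        rintro ⟨h1, h2⟩; exact ⟨h1, by omega⟩
    intro a ha b hb hab
    simp only [coe_range, Set.mem_Iio] at ha hb
    simp only at hab
    rcases Nat.lt_trichotomy (zz s h a) (zz s h b) with h1 | h1 | h1
    · have := key a b ha hb h1; omega
    · exact zz_inj a b ha hb h1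
    · have := key b a hb ha h1; omega
  have himg : (range s).image (fun a => (cR s h a).card) = range s := by
    apply Finset.eq_of_subset_of_card_le
    · intro x hx
      simp only [mem_image, mem_range] at hx ⊢
      obtain ⟨a, ha, rfl⟩ := hx
      have := card_total s h 0 a ha
      omega
    · rw [card_image_of_injOn hinj]
  conv_rhs => rw [← himg]
  rw [sum_image hinj]

theorem Np_bound {s : ℕ} {h : ℕ → ℕ} (H : Motz s h) (p : ℕ) (hp : 1 ≤ p) :
    ∑ a ∈ range s, (cA s h p a).card ≤
      ∑ i ∈ range s, (s - 2 * p - 1 - i) + (s - 2 * p + 1) / 2 := by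
  set n := s - 2 * p with hn
  set S := (range s).filter (fun a => (cA s h p a).Nonempty ∧
    (cA s h p a).card = n - (cR s h a).card) with hS
  have hle : ∀ a ∈ range s, (cA s h p a).card ≤
      (n - 1 - (cR s h a).card) + (if a ∈ S then 1 else 0) := by
    intro a ha
    rcases (cA s h p a).eq_empty_or_nonempty with h0 | h0
    · simp [h0]
    · have has := mem_range.1 ha
      have h1 := (key H p a hp has h0).1
      have h2 := card_total s h p a has
      split_ifs with hs
      · omega
      · have : (cA s h p a).card ≠ n - (cR s h a).card := by
          intro h3; exact hs (by simp only [hS, mem_filter]; exact ⟨ha, h0, h3⟩)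
        omega
  refine (sum_le_sum hle).trans ?_
  rw [sum_add_distrib, rank_sum s h (fun i => n - 1 - i)]
  apply Nat.add_le_add_left
  rw [← card_filter]
  have hSL : ∀ a ∈ S, a < s ∧ (cL s h a).card = 1 := by
    intro a ha
    simp only [hS, mem_filter, mem_range] at ha
    obtain ⟨has, h0, h1⟩ := ha
    have h2 := card_total s h p a has
    have h3 := card_pos.2 h0
    exact ⟨has, (key H p a hp has h0).2 (by omega)⟩
  have hfs : (range s).filter (fun a => a ∈ S) = S := by
    ext x; simp only [mem_filter, and_iff_right_iff_imp]
    intro hx; exact mem_range.2 (hSL x hx).1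
  rw [hfs]
  have hinj : Set.InjOn h (S : Set ℕ) := by
    have key2 : ∀ a b, a ∈ S → b ∈ S → h a = h b → ¬ a < b := by
      intro a b ha hb hab hlt
      obtain ⟨c, hc⟩ := card_pos.1 (show 0 < (cL s h b).card by rw [(hSL b hb).2]; omega)
      simp only [cL, mem_filter, mem_range] at hc
      have : 1 < (cL s h a).card := by
        apply Finset.one_lt_card.2
        refine ⟨b, ?_, c, ?_, by omega⟩
        · have := (hSL b hb).1
          simp only [cL, mem_filter, mem_range]; omega
        · simp only [cL, mem_filter, mem_range]; omega
      rw [(hSL a ha).2] at this; omega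
    intro a ha b hb hab
    have := key2 a b ha hb hab
    have := key2 b a hb ha hab.symm
    omega
  rw [← card_image_of_injOn hinj]
  have : S.image h ⊆ range ((n + 1) / 2) := by
    intro u hu
    simp only [mem_image] at hu
    obtain ⟨a, ha, rfl⟩ := hu
    simp only [hS, mem_filter, mem_range] at ha
    obtain ⟨has, ⟨b, hb⟩, -⟩ := ha
    simp only [cA, mem_filter, mem_range] at hb
    have h1 := (zz_lt_iff (h := h) p a b has hb.1).1 hb.2
    have h2 := H.two_mul_le b hb.1
    rw [mem_range]; omega
  simpa using card_le_card this

/-- Twice the size, as a quadratic form in the runner heights. -/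
def Q (s : ℕ) (h : ℕ → ℕ) : ℤ :=
  s * ∑ r ∈ range s, (h r : ℤ) ^ 2 - (∑ r ∈ range s, (h r : ℤ)) ^ 2
    + ∑ r ∈ range s, (2 * (r : ℤ) - s + 1) * h r

theorem quad_id (h : ℕ → ℤ) (N : ℕ) :
    ∑ b ∈ range N, ∑ a ∈ range b, ((h b - h a) ^ 2 + (h b - h a)) =
      N * ∑ r ∈ range N, (h r) ^ 2 - (∑ r ∈ range N, h r) ^ 2
        + ∑ r ∈ range N, (2 * (r : ℤ) - N + 1) * h r := by
  induction N with
  | zero => simp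
  | succ n ih =>
    rw [sum_range_succ, ih]
    simp only [sum_range_succ]
    have e1 : ∑ a ∈ range n, ((h n - h a) ^ 2 + (h n - h a)) =
        n * (h n) ^ 2 - 2 * h n * ∑ a ∈ range n, h a + ∑ a ∈ range n, h a ^ 2
          + n * h n - ∑ a ∈ range n, h a := by
      rw [mul_sum, sum_congr rfl (g := fun a => (h n ^ 2 + h n) - 2 * h n * h a + h a ^ 2 - h a)
        (fun a _ => by ring)]
      rw [sum_sub_distrib, sum_add_distrib, sum_sub_distrib]
      simp only [sum_const, card_range, nsmul_eq_mul]
      ring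
    have e2 : ∑ r ∈ range n, (2 * (r : ℤ) - ((n + 1 : ℕ) : ℤ) + 1) * h r =
        ∑ r ∈ range n, (2 * (r : ℤ) - n + 1) * h r - ∑ r ∈ range n, h r := by
      rw [← sum_sub_distrib]
      apply sum_congr rfl
      intro a _
      push_cast; ring
    rw [e1, e2]
    push_cast
    ring

theorem square_sum (G : ℕ → ℕ → ℤ) (N : ℕ) :
    ∑ a ∈ range N, ∑ b ∈ range N, G a b =
      ∑ b ∈ range N, (∑ a ∈ range b, (G a b + G b a) + G b b) := by
  induction N with
  | zero => simp
  | succ n ih =>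
    rw [sum_range_succ (fun b => ∑ a ∈ range b, (G a b + G b a) + G b b) n, ← ih]
    simp only [sum_range_succ, sum_add_distrib]
    ring

theorem tri_sum (K e : ℕ) (he : e ≤ K) :
    2 * ∑ p ∈ range (K + 1), (if p ≤ e then (p : ℤ) else 0) = e * (e + 1) := by
  induction K, he using Nat.le_induction with
  | base =>
    have hc : ∑ p ∈ range (e + 1), (if p ≤ e then (p : ℤ) else 0) =
        ∑ p ∈ range (e + 1), (p : ℤ) := by
      apply sum_congr rfl
      intro p hp; rw [if_pos (by simp at hp; omega)]
    rw [hc]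
    clear hc
    · induction e with
      | zero => simp
      | succ n ih => rw [sum_range_succ, mul_add, ih]; push_cast; ring
  | succ n hn ih =>
    rw [sum_range_succ, if_neg (by omega), add_zero, ih]

theorem Q_eq (s : ℕ) (h : ℕ → ℕ) (K : ℕ) (hK : ∀ r, r < s → h r ≤ K) :
    Q s h = 2 * ∑ p ∈ range (K + 1), (p : ℤ) * ∑ a ∈ range s, ((cA s h p a).card : ℤ) := by
  set G : ℕ → ℕ → ℤ := fun a b => 2 * ∑ p ∈ range (K + 1),
    if (h a + p < h b ∨ (h a + p = h b ∧ a < b)) then (p : ℤ) else 0 with hG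
  have hR : 2 * ∑ p ∈ range (K + 1), (p : ℤ) * ∑ a ∈ range s, ((cA s h p a).card : ℤ) =
      ∑ a ∈ range s, ∑ b ∈ range s, G a b := by
    simp only [hG, ← mul_sum]
    congr 1
    have : ∀ p ∈ range (K + 1), (p : ℤ) * ∑ a ∈ range s, ((cA s h p a).card : ℤ) =
        ∑ a ∈ range s, ∑ b ∈ range s,
          if (h a + p < h b ∨ (h a + p = h b ∧ a < b)) then (p : ℤ) else 0 := by
      intro p _
      rw [mul_sum]
      apply sum_congr rfl
      intro a ha
      rw [cA, card_filter, Nat.cast_sum, mul_sum]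
      apply sum_congr rfl
      intro b hb
      have := zz_lt_iff (h := h) p a b (mem_range.1 ha) (mem_range.1 hb)
      simp only [this]
      split_ifs <;> simp
    rw [sum_congr rfl this, sum_comm]
    apply sum_congr rfl
    intro a _
    rw [sum_comm]
  rw [hR, square_sum, Q, ← quad_id (fun r => (h r : ℤ))]
  apply sum_congr rfl
  intro b hb
  have hbs := mem_range.1 hb
  have hbb : G b b = 0 := by
    simp only [hG]
    rw [sum_eq_zero]; · simp
    intro p _
    rw [if_neg (by omega)]
  rw [hbb, add_zero]
  apply sum_congr rfl
  intro a ha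
  have hab := mem_range.1 ha
  have g1 : G a b = ((h b - h a : ℕ) : ℤ) * ((h b - h a : ℕ) + 1) := by
    rw [← tri_sum K (h b - h a) (by have := hK b hbs; omega)]
    simp only [hG]
    congr 1
    apply sum_congr rfl
    intro p _
    rcases Nat.eq_zero_or_pos p with rfl | hp
    · simp
    · congr 1
      apply propext; omega
  have g2 : G b a = ((h a - h b - 1 : ℕ) : ℤ) * ((h a - h b - 1 : ℕ) + 1) := by
    rw [← tri_sum K (h a - h b - 1) (by have := hK a (by omega); omega)]
    simp only [hG]
    congr 1
    apply sum_congr rfl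
    intro p _
    rcases Nat.eq_zero_or_pos p with rfl | hp
    · simp
    · congr 1
      apply propext; omega
  rw [g1, g2]
  rcases Nat.lt_or_ge (h b) (h a) with h1 | h1
  · obtain ⟨d, hd⟩ := Nat.exists_eq_add_of_lt h1
    rw [show h b - h a = 0 by omega, show h a - h b - 1 = d by omega, hd]
    push_cast; ring
  · obtain ⟨d, hd⟩ := Nat.exists_eq_add_of_le h1
    rw [show h b - h a = d by omega, show h a - h b - 1 = 0 by omega, hd]
    push_cast; ring

/-- bound on the number of pairs at distance more than `p s` -/
def MM (s p : ℕ) : ℕ := ∑ i ∈ range s, (s - 2 * p - 1 - i) + (s - 2 * p + 1) / 2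

theorem Q_le {s : ℕ} {h : ℕ → ℕ} (H : Motz s h) :
    Q s h ≤ 2 * ∑ p ∈ range (s + 1), (p : ℤ) * (MM s p : ℤ) := by
  rw [Q_eq s h s (fun r hr => by have := H.le_left r hr; omega)]
  refine mul_le_mul_of_nonneg_left (sum_le_sum fun p _ => ?_) (by norm_num)
  rcases Nat.eq_zero_or_pos p with rfl | hp
  · rw [Nat.cast_zero, zero_mul, zero_mul]
  · have := Np_bound H p hp
    rw [← Nat.cast_sum]
    gcongr
    exact_mod_cast this

theorem sub_sum (s n : ℕ) (hn : n ≤ s) :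
    2 * ∑ i ∈ range s, ((n - 1 - i : ℕ) : ℤ) = n * (n - 1) := by
  induction s, hn using Nat.le_induction with
  | base =>
    induction n with
    | zero => simp
    | succ n ih =>
      rw [sum_range_succ']
      have : ∀ i ∈ range n, ((n + 1 - 1 - (i + 1) : ℕ) : ℤ) = ((n - 1 - i : ℕ) : ℤ) := by
        intro i _; congr 1; omega
      rw [sum_congr rfl this, mul_add, ih]; push_cast; simp; ring
  | succ m hm ih =>
    rw [sum_range_succ, mul_add, ih, show n - 1 - m = 0 by omega]; simp

theorem MM_zero (s p : ℕ) (h : s ≤ 2 * p) : MM s p = 0 := by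
  unfold MM
  rw [show s - 2 * p = 0 by omega]; simp

theorem MM_even (k p : ℕ) (h : p ≤ k) : (MM (2 * k) p : ℤ) = 2 * ((k : ℤ) - p) ^ 2 := by
  have h1 := sub_sum (2 * k) (2 * k - 2 * p) (by omega)
  obtain ⟨q, rfl⟩ := Nat.exists_eq_add_of_le h
  unfold MM
  rw [show 2 * (p + q) - 2 * p = 2 * q by omega] at *
  rw [show (2 * q + 1) / 2 = q by omega]
  push_cast at h1 ⊢
  linarith

theorem MM_odd (k p : ℕ) (h : p ≤ k) :
    (MM (2 * k + 1) p : ℤ) = 2 * ((k : ℤ) - p) ^ 2 + 2 * ((k : ℤ) - p) + 1 := by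
  have h1 := sub_sum (2 * k + 1) (2 * k + 1 - 2 * p) (by omega)
  obtain ⟨q, rfl⟩ := Nat.exists_eq_add_of_le h
  unfold MM
  rw [show 2 * (p + q) + 1 - 2 * p = 2 * q + 1 by omega] at *
  rw [show (2 * q + 1 + 1) / 2 = q + 1 by omega]
  push_cast at h1 ⊢
  linarith

theorem MM_restrict (s k : ℕ) (h : s ≤ 2 * k + 1) (hk : k ≤ s) :
    ∑ p ∈ range (s + 1), (p : ℤ) * (MM s p : ℤ) = ∑ p ∈ range (k + 1), (p : ℤ) * (MM s p : ℤ) := by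
  symm
  apply sum_subset
  · intro x; simp only [mem_range]; omega
  · intro x _ hx
    simp only [mem_range] at hx
    rw [MM_zero s x (by omega)]; simp

theorem poly_even (k : ℤ) (N : ℕ) : 12 * ∑ p ∈ range N, (p : ℤ) * (k - p) ^ 2 =
    6 * k ^ 2 * N * (N - 1) - 4 * k * N * (N - 1) * (2 * N - 1) + 3 * N ^ 2 * (N - 1) ^ 2 := by
  induction N with
  | zero => simp
  | succ n ih => rw [sum_range_succ, mul_add, ih]; push_cast; ring

theorem poly_odd (k : ℤ) (N : ℕ) :
    6 * ∑ p ∈ range N, (p : ℤ) * (2 * (k - p) ^ 2 + 2 * (k - p) + 1) =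
    6 * k ^ 2 * N * (N - 1) - 4 * k * N * (N - 1) * (2 * N - 1) + 3 * N ^ 2 * (N - 1) ^ 2
     + 6 * k * N * (N - 1) - 2 * N * (N - 1) * (2 * N - 1) + 3 * N * (N - 1) := by
  induction N with
  | zero => simp
  | succ n ih => rw [sum_range_succ, mul_add, ih]; push_cast; ring

theorem choose3 (n : ℕ) : 6 * ((n + 1).choose 3 : ℤ) = (n + 1) * n * (n - 1) := by
  have h2 : ∀ n : ℕ, 2 * ((n + 1).choose 2 : ℤ) = (n + 1) * n := by
    intro n
    induction n with
    | zero => simp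
    | succ n ih =>
      rw [Nat.choose_succ_succ' (n + 1) 1]; push_cast; rw [mul_add, ih]; simp; ring
  induction n with
  | zero => simp [Nat.choose]
  | succ n ih =>
    rw [Nat.choose_succ_succ' (n + 1) 2]; push_cast; rw [mul_add, ih]
    have := h2 n
    linear_combination 3 * this

theorem Q_le_even {k : ℕ} {h : ℕ → ℕ} (H : Motz (2 * k) h) :
    Q (2 * k) h ≤ 2 * (k * (k + 1).choose 3 : ℕ) := by
  refine (Q_le H).trans (le_of_eq ?_)
  rw [MM_restrict (2 * k) k (by omega) (by omega)]
  have e : ∑ p ∈ range (k + 1), (p : ℤ) * (MM (2 * k) p : ℤ) =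
      2 * ∑ p ∈ range (k + 1), (p : ℤ) * ((k : ℤ) - p) ^ 2 := by
    rw [mul_sum]
    apply sum_congr rfl
    intro p hp
    rw [MM_even k p (by simp at hp; omega)]; ring
  have h1 := poly_even k (k + 1)
  have h2 := choose3 k
  rw [e]
  push_cast at *
  have : (6 : ℤ) * (2 * (k * ((k + 1).choose 3 : ℤ))) = 2 * k * ((k + 1) * k * (k - 1)) := by
    rw [← h2]; ring
  linarith

theorem Q_le_odd {k : ℕ} {h : ℕ → ℕ} (H : Motz (2 * k + 1) h) :
    Q (2 * k + 1) h ≤ 2 * ((k + 1) * (k + 1).choose 3 + (k + 2).choose 3 : ℕ) := by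
  refine (Q_le H).trans (le_of_eq ?_)
  rw [MM_restrict (2 * k + 1) k (by omega) (by omega)]
  have e : ∑ p ∈ range (k + 1), (p : ℤ) * (MM (2 * k + 1) p : ℤ) =
      ∑ p ∈ range (k + 1), (p : ℤ) * (2 * ((k : ℤ) - p) ^ 2 + 2 * ((k : ℤ) - p) + 1) := by
    apply sum_congr rfl
    intro p hp
    rw [MM_odd k p (by simp at hp; omega)]
  have h1 := poly_odd k (k + 1)
  have h2 := choose3 k
  have h3 := choose3 (k + 1)
  rw [e]
  push_cast at *
  have : (6 : ℤ) * (2 * ((k + 1) * ((k + 1).choose 3 : ℤ))) =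
      2 * (k + 1) * ((k + 1) * k * (k - 1)) := by
    rw [← h2]; ring
  rw [show k + 1 + 1 = k + 2 from rfl] at h3
  linarith

/-- The maximal path. -/
def tent (s r : ℕ) : ℕ := min r (s - 1 - r)

theorem tent_motz (s : ℕ) : Motz s (tent s) := by
  constructor <;> intros <;> simp only [tent] <;> omega

theorem sum_even (F : ℕ → ℤ) (k : ℕ) : ∑ r ∈ range (2 * k), F r =
    ∑ r ∈ range k, (F r + F (2 * k - 1 - r)) := by
  rw [two_mul, sum_range_add, sum_add_distrib]
  congr 1
  rw [← sum_range_reflect]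
  apply sum_congr rfl
  intro r hr
  simp at hr
  congr 1; omega

theorem sum_odd (F : ℕ → ℤ) (k : ℕ) : ∑ r ∈ range (2 * k + 1), F r =
    ∑ r ∈ range k, (F r + F (2 * k - r)) + F k := by
  rw [show 2 * k + 1 = k + (1 + k) by omega, sum_range_add, sum_range_add, sum_add_distrib]
  have : ∑ x ∈ range k, F (k + (1 + x)) = ∑ r ∈ range k, F (2 * k - r) := by
    rw [← sum_range_reflect]
    apply sum_congr rfl
    intro r hr
    simp at hr
    congr 1; omega
  rw [this]; simp; ring

theorem s1 (k : ℕ) : 2 * ∑ r ∈ range k, (r : ℤ) = k * (k - 1) := by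
  induction k with
  | zero => simp
  | succ n ih => rw [sum_range_succ, mul_add, ih]; push_cast; ring

theorem s2 (k : ℕ) : 6 * ∑ r ∈ range k, (r : ℤ) ^ 2 = k * (k - 1) * (2 * k - 1) := by
  induction k with
  | zero => simp
  | succ n ih => rw [sum_range_succ, mul_add, ih]; push_cast; ring

theorem Q_tent_even (k : ℕ) :
    Q (2 * k) (tent (2 * k)) = 2 * (k * (k + 1).choose 3 : ℕ) := by
  unfold Q
  simp only [sum_even]
  have a1 : ∑ r ∈ range k, ((tent (2 * k) r : ℤ) ^ 2 + (tent (2 * k) (2 * k - 1 - r) : ℤ) ^ 2) =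
      2 * ∑ r ∈ range k, (r : ℤ) ^ 2 := by
    rw [mul_sum]
    apply sum_congr rfl
    intro r hr
    simp at hr
    rw [show tent (2 * k) r = r by unfold tent; omega,
      show tent (2 * k) (2 * k - 1 - r) = r by unfold tent; omega]
    ring
  have a2 : ∑ r ∈ range k, ((tent (2 * k) r : ℤ) + (tent (2 * k) (2 * k - 1 - r) : ℤ)) =
      2 * ∑ r ∈ range k, (r : ℤ) := by
    rw [mul_sum]
    apply sum_congr rfl
    intro r hr
    simp at hr
    rw [show tent (2 * k) r = r by unfold tent; omega,
      show tent (2 * k) (2 * k - 1 - r) = r by unfold tent; omega]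
    ring
  have a3 : ∑ r ∈ range k, ((2 * (r : ℤ) - ((2 * k : ℕ) : ℤ) + 1) * (tent (2 * k) r : ℤ) +
      (2 * ((2 * k - 1 - r : ℕ) : ℤ) - ((2 * k : ℕ) : ℤ) + 1) * (tent (2 * k) (2 * k - 1 - r) : ℤ)) = 0 := by
    apply sum_eq_zero
    intro r hr
    simp at hr
    rw [show tent (2 * k) r = r by unfold tent; omega,
      show tent (2 * k) (2 * k - 1 - r) = r by unfold tent; omega]
    rw [Nat.cast_sub (by omega), Nat.cast_sub (by omega)]
    push_cast; ring
  rw [a1, a2, a3]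
  · have h1 := s1 k
    have h2 := s2 k
    have h3 := choose3 k
    rw [h1]
    push_cast
    have e : (6 : ℤ) * (2 * (k * ((k + 1).choose 3 : ℤ))) = 2 * k * ((k + 1) * k * (k - 1)) := by
      rw [← h3]; ring
    have e2 : (6 : ℤ) * (2 * k * (2 * ∑ r ∈ range k, (r : ℤ) ^ 2)) =
      4 * k * (k * (k - 1) * (2 * k - 1)) := by rw [← h2]; ring
    linarith

theorem Q_tent_odd (k : ℕ) :
    Q (2 * k + 1) (tent (2 * k + 1)) =
      2 * ((k + 1) * (k + 1).choose 3 + (k + 2).choose 3 : ℕ) := by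
  unfold Q
  simp only [sum_odd]
  have t0 : tent (2 * k + 1) k = k := by unfold tent; omega
  have a1 : ∑ r ∈ range k,
      ((tent (2 * k + 1) r : ℤ) ^ 2 + (tent (2 * k + 1) (2 * k - r) : ℤ) ^ 2) =
      2 * ∑ r ∈ range k, (r : ℤ) ^ 2 := by
    rw [mul_sum]
    apply sum_congr rfl
    intro r hr
    simp at hr
    rw [show tent (2 * k + 1) r = r by unfold tent; omega,
      show tent (2 * k + 1) (2 * k - r) = r by unfold tent; omega]
    ring
  have a2 : ∑ r ∈ range k, ((tent (2 * k + 1) r : ℤ) + (tent (2 * k + 1) (2 * k - r) : ℤ)) =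
      2 * ∑ r ∈ range k, (r : ℤ) := by
    rw [mul_sum]
    apply sum_congr rfl
    intro r hr
    simp at hr
    rw [show tent (2 * k + 1) r = r by unfold tent; omega,
      show tent (2 * k + 1) (2 * k - r) = r by unfold tent; omega]
    ring
  have a3 : ∑ r ∈ range k, ((2 * (r : ℤ) - ((2 * k + 1 : ℕ) : ℤ) + 1) * (tent (2 * k + 1) r : ℤ) +
      (2 * ((2 * k - r : ℕ) : ℤ) - ((2 * k + 1 : ℕ) : ℤ) + 1) * (tent (2 * k + 1) (2 * k - r) : ℤ)) = 0 := by
    apply sum_eq_zero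
    intro r hr
    simp at hr
    rw [show tent (2 * k + 1) r = r by unfold tent; omega,
      show tent (2 * k + 1) (2 * k - r) = r by unfold tent; omega]
    rw [Nat.cast_sub (by omega)]
    push_cast; ring
  rw [a1, a2, a3, t0]
  · have h1 := s1 k
    have h2 := s2 k
    have h3 := choose3 k
    have h4 := choose3 (k + 1)
    rw [h1]
    push_cast at *
    have e : (6 : ℤ) * (2 * ((k + 1) * ((k + 1).choose 3 : ℤ))) =
        2 * (k + 1) * ((k + 1) * k * (k - 1)) := by
      rw [← h3]; ring
    have e2 : (6 : ℤ) * ((2 * k + 1) * (2 * ∑ r ∈ range k, (r : ℤ) ^ 2)) =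
      2 * (2 * k + 1) * (k * (k - 1) * (2 * k - 1)) := by rw [← h2]; ring
    rw [show k + 1 + 1 = k + 2 from rfl] at h4
    linarith

/-- `X` is described by the runner heights `h`. -/
theorem abacus_sum (s : ℕ) (hs : 0 < s) (h : ℕ → ℕ) (X : Finset ℕ)
    (hX : ∀ x, x ∈ X ↔ x / s < h (x % s)) (f : ℕ → ℤ) :
    ∑ x ∈ X, f x = ∑ r ∈ range s, ∑ m ∈ range (h r), f (r + s * m) := by
  rw [sum_sigma']
  refine sum_bij' (fun x _ => (⟨x % s, x / s⟩ : (_ : ℕ) × ℕ)) (fun y _ => y.1 + s * y.2) ?_ ?_ ?_ ?_ ?_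
  · intro x hx
    simp only [mem_sigma, mem_range]
    exact ⟨Nat.mod_lt _ hs, (hX x).1 hx⟩
  · rintro ⟨r, m⟩ hy
    simp only [mem_sigma, mem_range] at hy
    rw [hX]
    simp only [Nat.add_mul_mod_self_left, Nat.add_mul_div_left _ _ hs, Nat.mod_eq_of_lt hy.1,
      Nat.div_eq_of_lt hy.1]
    omega
  · intro x _
    exact Nat.mod_add_div x s
  · rintro ⟨r, m⟩ hy
    simp only [mem_sigma, mem_range] at hy
    simp only [Nat.add_mul_mod_self_left, Nat.add_mul_div_left _ _ hs, Nat.mod_eq_of_lt hy.1,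
      Nat.div_eq_of_lt hy.1, zero_add]
  · intro x _
    rw [Nat.mod_add_div x s]

theorem Q_of_abacus (s : ℕ) (hs : 0 < s) (h : ℕ → ℕ) (X : Finset ℕ)
    (hX : ∀ x, x ∈ X ↔ x / s < h (x % s)) :
    Q s h = 2 * ∑ x ∈ X, (x : ℤ) - X.card * (X.card - 1) := by
  have h1 := abacus_sum s hs h X hX (fun x => (x : ℤ))
  have h2 := abacus_sum s hs h X hX (fun _ => 1)
  simp only [sum_const, card_range, nsmul_eq_mul, mul_one] at h2
  rw [h1, h2, mul_sum]
  have : ∀ r ∈ range s, 2 * ∑ m ∈ range (h r), ((r + s * m : ℕ) : ℤ) =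
      s * (h r : ℤ) ^ 2 + (2 * (r : ℤ) - s + 1) * h r - h r := by
    intro r _
    push_cast
    rw [sum_add_distrib, ← mul_sum, mul_add, mul_left_comm, s1]
    simp; ring
  rw [sum_congr rfl this, sum_sub_distrib, sum_add_distrib, Q, ← mul_sum]
  ring

namespace NPartition

theorem parts_eq_zero_iff (lam : NPartition) (i : ℕ) : lam.parts i = 0 ↔ lam.numParts ≤ i := by
  constructor
  · intro h; exact Nat.sInf_le h
  · intro h
    have hne : {N | lam.parts N = 0}.Nonempty := by
      obtain ⟨N, hN⟩ := lam.eventually_zero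
      exact ⟨N, hN N le_rfl⟩
    have h1 : lam.parts lam.numParts = 0 := Nat.sInf_mem hne
    have := lam.antitone h
    omega

theorem size_eq (lam : NPartition) : lam.size = ∑ i ∈ range lam.numParts, lam.parts i := by
  unfold size
  apply finsum_eq_sum_of_support_subset
  intro i hi
  simp only [Function.mem_support] at hi
  have := lam.parts_eq_zero_iff i
  simp only [coe_range, Set.mem_Iio]
  omega

theorem lt_conj_iff (lam : NPartition) (i j : ℕ) : i < lam.conj.parts j ↔ j < lam.parts i := by
  show i < ((range lam.numParts).filter (fun i => j < lam.parts i)).card ↔ _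
  constructor
  · intro h
    by_contra hcon
    have : (range lam.numParts).filter (fun i => j < lam.parts i) ⊆ range i := by
      intro x hx
      simp only [mem_filter, mem_range] at hx ⊢
      by_contra hxi
      have := lam.antitone (show i ≤ x by omega)
      omega
    have := card_le_card this
    simp at this; omega
  · intro h
    have : range (i + 1) ⊆ (range lam.numParts).filter (fun i => j < lam.parts i) := by
      intro x hx
      simp only [mem_filter, mem_range] at hx ⊢
      have := lam.antitone (show x ≤ i by omega)
      have := lam.parts_eq_zero_iff x
      omega
    have := card_le_card this
    simp at this; omega

/-- The first-column hook length of row `i`. -/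
noncomputable def bead (lam : NPartition) (i : ℕ) : ℕ := lam.parts i + (lam.numParts - (i + 1))

theorem bead_anti (lam : NPartition) (i j : ℕ) (hij : i < j) (hj : j < lam.numParts) :
    lam.bead j < lam.bead i := by
  have := lam.antitone hij.le
  unfold bead; omega

theorem bead_ge (lam : NPartition) (i : ℕ) (hi : i < lam.numParts) :
    lam.numParts - i ≤ lam.bead i := by
  have := lam.parts_eq_zero_iff i
  unfold bead; omega

/-- The set of first-column hook lengths. -/
noncomputable def beads (lam : NPartition) : Finset ℕ := (range lam.numParts).image lam.bead

theorem mem_beads (lam : NPartition) (x : ℕ) :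
    x ∈ lam.beads ↔ ∃ i < lam.numParts, lam.bead i = x := by
  simp [beads]

theorem bead_inj (lam : NPartition) : Set.InjOn lam.bead (range lam.numParts : Set ℕ) := by
  intro a ha b hb hab
  simp only [coe_range, Set.mem_Iio] at ha hb
  rcases Nat.lt_trichotomy a b with h | h | h
  · have := lam.bead_anti a b h hb; omega
  · exact h
  · have := lam.bead_anti b a h ha; omega

theorem zero_notMem_beads (lam : NPartition) : 0 ∉ lam.beads := by
  rw [mem_beads]
  rintro ⟨i, hi, h⟩
  have := lam.bead_ge i hi
  omega

theorem two_size (lam : NPartition) :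
    2 * (lam.size : ℤ) = 2 * ∑ x ∈ lam.beads, (x : ℤ) - lam.beads.card * (lam.beads.card - 1) := by
  have hc : lam.beads.card = lam.numParts := by
    rw [beads, card_image_of_injOn lam.bead_inj, card_range]
  rw [hc, beads, sum_image lam.bead_inj, size_eq]
  have h1 := sub_sum lam.numParts lam.numParts le_rfl
  rw [← h1]
  have h2 : ∑ i ∈ range lam.numParts, ((lam.bead i : ℕ) : ℤ) =
      ∑ i ∈ range lam.numParts, (lam.parts i : ℤ) +
      ∑ i ∈ range lam.numParts, ((lam.numParts - 1 - i : ℕ) : ℤ) := by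
    rw [← sum_add_distrib]
    apply sum_congr rfl
    intro i _
    rw [bead, Nat.cast_add]
    congr 2; omega
  rw [h2]; push_cast; ring

theorem isCore_iff (lam : NPartition) (t : ℕ) :
    IsCore t lam ↔ ∀ x ∈ lam.beads, t ≤ x → x - t ∈ lam.beads := by
  constructor
  · intro hcore x hx htx
    obtain ⟨i, hi, rfl⟩ := (lam.mem_beads x).1 hx
    by_contra hy
    have ht0 : t ≠ 0 := by rintro rfl; exact hy (by simpa using hx)
    set y := lam.bead i - t with hydef
    have hyi : y < lam.bead i := by omega
    have hex : ∃ c, lam.numParts ≤ c ∨ lam.bead c ≤ y := ⟨_, Or.inl le_rfl⟩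
    obtain ⟨c, hc1, hc2⟩ : ∃ c, (lam.numParts ≤ c ∨ lam.bead c ≤ y) ∧
        ∀ c' < c, ¬ (lam.numParts ≤ c' ∨ lam.bead c' ≤ y) := by
      classical
      exact ⟨Nat.find hex, Nat.find_spec hex, fun c' h => Nat.find_min hex h⟩
    have hcm : c ≤ lam.numParts := by
      by_contra hcon
      exact hc2 lam.numParts (by omega) (Or.inl le_rfl)
    have hcy : c < lam.numParts → lam.bead c < y := by
      intro h
      have h1 : lam.bead c ≤ y := by omega
      have h2 : lam.bead c ≠ y := fun h3 => hy ((lam.mem_beads y).2 ⟨c, h, h3⟩)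
      omega
    have hic : i < c := by
      by_contra hcon
      have h1 : lam.bead c ≤ y := by omega
      rcases Nat.eq_or_lt_of_le (show c ≤ i by omega) with h | h
      · subst h; omega
      · have := lam.bead_anti c i h hi; omega
    have hym : lam.numParts - c ≤ y := by
      rcases Nat.eq_or_lt_of_le hcm with h | h
      · omega
      · have := lam.bead_ge c h
        have := hcy h
        omega
    obtain ⟨j, hj⟩ : ∃ j, y = j + (lam.numParts - c) := ⟨y - (lam.numParts - c), by omega⟩
    have hconj : lam.conj.parts j = c := by
      apply le_antisymm
      · by_contra hcon
        have h1 := (lam.lt_conj_iff c j).1 (by omega)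
        rcases Nat.eq_or_lt_of_le hcm with h | h
        · have := (lam.parts_eq_zero_iff c).2 (by omega); omega
        · have := hcy h
          unfold bead at this; omega
      · have h1 : j < lam.parts (c - 1) := by
          have := hc2 (c - 1) (by omega)
          push Not at this
          have := this.2
          unfold bead at this; omega
        have := (lam.lt_conj_iff (c - 1) j).2 h1
        omega
    have hji : j < lam.parts i := (lam.lt_conj_iff i j).1 (by omega)
    apply hcore i j hji
    unfold hookLength
    rw [hconj]
    unfold bead at hydef hyi htx
    omega
  · intro hcl i j hj hhook
    have hi : i < lam.numParts := by
      have := lam.parts_eq_zero_iff i; omega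
    have hic := (lam.lt_conj_iff i j).2 hj
    set c := lam.conj.parts j with hc
    have hcm : c ≤ lam.numParts := by
      have h1 := (lam.lt_conj_iff (c - 1) j).1 (by omega)
      have := lam.parts_eq_zero_iff (c - 1)
      omega
    unfold hookLength at hhook
    rw [← hc] at hhook
    have hb : lam.bead i = j + (lam.numParts - c) + t := by unfold bead; omega
    have := hcl (lam.bead i) ((lam.mem_beads _).2 ⟨i, hi, rfl⟩) (by omega)
    rw [hb, Nat.add_sub_cancel] at this
    obtain ⟨i', hi', h'⟩ := (lam.mem_beads _).1 this
    have hiff := lam.lt_conj_iff i' j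
    rw [← hc] at hiff
    unfold bead at h'
    omega

theorem exists_of_beads (X : Finset ℕ) (h0 : 0 ∉ X) : ∃ lam : NPartition, lam.beads = X := by
  set m := X.card with hm
  obtain ⟨e, he1, he2⟩ : ∃ e : ℕ → ℕ, (∀ a b, a < b → b < m → e a < e b) ∧
      X = (range m).image e := by
    refine ⟨fun a => if h : a < m then X.orderEmbOfFin hm.symm ⟨a, h⟩ else 0, ?_, ?_⟩
    · intro a b hab hb
      simp only [hb, hab.trans hb, dif_pos]
      exact (X.orderEmbOfFin hm.symm).strictMono hab
    · ext x
      simp only [mem_image, mem_range]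
      constructor
      · intro hx
        have : x ∈ Set.range (X.orderEmbOfFin hm.symm) := by
          rw [Finset.range_orderEmbOfFin]; exact hx
        obtain ⟨⟨a, ha⟩, rfl⟩ := this
        exact ⟨a, ha, by simp [ha]⟩
      · rintro ⟨a, ha, rfl⟩
        simp only [ha, dif_pos]
        exact Finset.orderEmbOfFin_mem _ _ _
  have hpos : ∀ a, a < m → a + 1 ≤ e a := by
    intro a
    induction a with
    | zero =>
      intro h
      have : e 0 ≠ 0 := by
        intro h1; apply h0; rw [he2]; exact mem_image.2 ⟨0, by simpa using h, h1⟩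
      omega
    | succ n ih =>
      intro h
      have := ih (by omega)
      have := he1 n (n + 1) (by omega) h
      omega
  have hstep : ∀ a b, a ≤ b → b < m → e a + (b - a) ≤ e b := by
    intro a b hab
    induction b, hab using Nat.le_induction with
    | base => intro _; omega
    | succ n hn ih =>
      intro h
      have := ih (by omega)
      have := he1 n (n + 1) (by omega) h
      omega
  let lam : NPartition :=
    { parts := fun i => if i < m then e (m - 1 - i) - (m - 1 - i) else 0
      antitone := by
        intro i j hij
        split_ifs with h1 h2
        · have := hstep (m - 1 - j) (m - 1 - i) (by omega) (by omega)
          have := hpos (m - 1 - j) (by omega)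
          omega
        · omega
        · omega
        · omega
      eventually_zero := ⟨m, fun i hi => by rw [if_neg (by omega)]⟩ }
  have hparts : ∀ i, lam.parts i = if i < m then e (m - 1 - i) - (m - 1 - i) else 0 := fun _ => rfl
  have hnum : lam.numParts = m := by
    apply le_antisymm
    · rw [← parts_eq_zero_iff, hparts, if_neg (by omega)]
    · by_contra hcon
      have h1 := (lam.parts_eq_zero_iff lam.numParts).2 le_rfl
      rw [hparts, if_pos (by omega)] at h1
      have := hpos (m - 1 - lam.numParts) (by omega)
      omega
  have hbead : ∀ i, i < m → lam.bead i = e (m - 1 - i) := by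
    intro i hi
    have := hpos (m - 1 - i) (by omega)
    rw [bead, hnum, hparts, if_pos hi]; omega
  refine ⟨lam, ?_⟩
  ext x
  rw [mem_beads, he2, hnum]
  simp only [mem_image, mem_range]
  constructor
  · rintro ⟨i, hi, rfl⟩
    exact ⟨m - 1 - i, by omega, (hbead i hi).symm⟩
  · rintro ⟨a, ha, rfl⟩
    refine ⟨m - 1 - a, by omega, ?_⟩
    rw [hbead _ (by omega)]; congr 1; omega

end NPartition

open NPartition

theorem core_to_motz (s : ℕ) (hs : 2 < s) (lam : NPartition) (h1 : IsCore (s - 1) lam)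
    (h2 : IsCore s lam) (h3 : IsCore (s + 1) lam) :
    ∃ h : ℕ → ℕ, Motz s h ∧ 2 * (lam.size : ℤ) = Q s h := by
  rw [isCore_iff] at h1 h2 h3
  have h0 := lam.zero_notMem_beads
  have hex : ∀ r, ∃ m, r + s * m ∉ lam.beads := by
    intro r
    refine ⟨lam.beads.sup id + 1, fun hmem => ?_⟩
    have := Finset.le_sup (f := id) hmem
    simp only [id] at this
    nlinarith
  classical
  set h : ℕ → ℕ := fun r => Nat.find (hex r) with hh
  have hiff : ∀ r m, r + s * m ∈ lam.beads ↔ m < h r := by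
    intro r m
    constructor
    · intro hmem
      by_contra hcon
      have hdown : ∀ d, d ≤ m → r + s * (m - d) ∈ lam.beads := by
        intro d
        induction d with
        | zero => intro _; simpa using hmem
        | succ n ih =>
          intro hn
          have h4 := ih (by omega)
          have e : s * (m - n) = s * (m - (n + 1)) + s := by
            rw [show m - n = (m - (n + 1)) + 1 by omega]; ring
          have h5 := h2 _ h4 (by omega)
          rwa [e, ← add_assoc, Nat.add_sub_cancel] at h5
      have h6 := hdown (m - h r) (by omega)
      rw [show m - (m - h r) = h r by omega] at h6
      exact Nat.find_spec (hex r) h6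
    · intro hlt
      have := Nat.find_min (hex r) hlt
      simpa using this
  refine ⟨h, ⟨?_, ?_, ?_, ?_⟩, ?_⟩
  · by_contra hcon
    have := (hiff 0 0).2 (by omega)
    simp at this; exact h0 this
  · by_contra hcon
    have := (hiff (s - 1) 0).2 (by omega)
    have := h1 _ this (by omega)
    simp at this; exact h0 this
  · intro r hr
    by_contra hcon
    have h4 := (hiff (r + 1) (h r + 1)).2 (by omega)
    rw [show r + 1 + s * (h r + 1) = r + s * h r + (s + 1) by ring] at h4
    have h5 := h3 _ h4 (by omega)
    rw [Nat.add_sub_cancel, hiff] at h5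
    omega
  · intro r hr
    by_contra hcon
    have h4 := (hiff r (h (r + 1) + 1)).2 (by omega)
    have e : r + s * (h (r + 1) + 1) = r + 1 + s * h (r + 1) + (s - 1) := by
      rw [mul_add]; omega
    rw [e] at h4
    have h5 := h1 _ h4 (by omega)
    rw [Nat.add_sub_cancel, hiff] at h5
    omega
  · rw [two_size, Q_of_abacus s (by omega) h lam.beads]
    intro x
    rw [← hiff, Nat.mod_add_div]

theorem motz_to_core (s : ℕ) (hs : 2 < s) (h : ℕ → ℕ) (H : Motz s h) :
    ∃ lam : NPartition, IsCore (s - 1) lam ∧ IsCore s lam ∧ IsCore (s + 1) lam ∧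
      2 * (lam.size : ℤ) = Q s h := by
  set X := (range (s * s)).filter (fun x => x / s < h (x % s)) with hXdef
  have hX : ∀ x, x ∈ X ↔ x / s < h (x % s) := by
    intro x
    simp only [hXdef, mem_filter, mem_range, and_iff_right_iff_imp]
    intro hx
    have h1 := H.le_left (x % s) (Nat.mod_lt _ (by omega))
    have h2 := Nat.mod_lt x (show s > 0 by omega)
    rw [← Nat.div_lt_iff_lt_mul (by omega)]
    omega
  have hX' : ∀ r m, r < s → (r + s * m ∈ X ↔ m < h r) := by
    intro r m hr
    rw [hX, Nat.add_mul_mod_self_left, Nat.add_mul_div_left _ _ (by omega),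
      Nat.mod_eq_of_lt hr, Nat.div_eq_of_lt hr, zero_add]
  have h0 : 0 ∉ X := by rw [hX]; simp [H.zero]
  obtain ⟨lam, hlam⟩ := exists_of_beads X h0
  refine ⟨lam, ?_, ?_, ?_, ?_⟩
  · rw [isCore_iff, hlam]
    intro x hx htx
    obtain ⟨r, m, hr, rfl⟩ : ∃ r m, r < s ∧ x = r + s * m :=
      ⟨x % s, x / s, Nat.mod_lt _ (by omega), (Nat.mod_add_div x s).symm⟩
    rw [hX' r m hr] at hx
    have hr1 : r ≠ s - 1 := by rintro rfl; rw [H.last] at hx; omega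
    rcases m with _ | m
    · simp at htx; omega
    · rw [show r + s * (m + 1) - (s - 1) = (r + 1) + s * m by rw [mul_add]; omega,
        hX' _ _ (by omega)]
      have := H.dn r (by omega)
      omega
  · rw [isCore_iff, hlam]
    intro x hx htx
    obtain ⟨r, m, hr, rfl⟩ : ∃ r m, r < s ∧ x = r + s * m :=
      ⟨x % s, x / s, Nat.mod_lt _ (by omega), (Nat.mod_add_div x s).symm⟩
    rw [hX' r m hr] at hx
    rcases m with _ | m
    · simp at htx; omega
    · rw [show r + s * (m + 1) - s = r + s * m by rw [mul_add]; omega, hX' _ _ hr]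
      omega
  · rw [isCore_iff, hlam]
    intro x hx htx
    obtain ⟨r, m, hr, rfl⟩ : ∃ r m, r < s ∧ x = r + s * m :=
      ⟨x % s, x / s, Nat.mod_lt _ (by omega), (Nat.mod_add_div x s).symm⟩
    rw [hX' r m hr] at hx
    rcases r with _ | r
    · rw [H.zero] at hx; omega
    rcases m with _ | m
    · simp at htx; omega
    · rw [show r + 1 + s * (m + 1) - (s + 1) = r + s * m by rw [mul_add]; omega,
        hX' _ _ (by omega)]
      have := H.up r (by omega)
      omega
  · rw [two_size, hlam, Q_of_abacus s (by omega) h X hX]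


end TripleCore

/-- Let `s > 2`.  The maximal size of a simultaneous
`(s-1, s, s+1)`-core is `k·C(k+1,3)` if `s = 2k` is even, and
`(k+1)·C(k+1,3) + C(k+2,3)` if `s = 2k+1` is odd. -/
theorem maximal_triple_core_size (s : ℕ) (hs : 2 < s) :
    (∀ k : ℕ, s = 2 * k →
      IsGreatest {n : ℕ | ∃ lam : NPartition, NPartition.IsCore (s - 1) lam ∧
          NPartition.IsCore s lam ∧ NPartition.IsCore (s + 1) lam ∧ lam.size = n}
        (k * Nat.choose (k + 1) 3)) ∧
    (∀ k : ℕ, s = 2 * k + 1 →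
      IsGreatest {n : ℕ | ∃ lam : NPartition, NPartition.IsCore (s - 1) lam ∧
          NPartition.IsCore s lam ∧ NPartition.IsCore (s + 1) lam ∧ lam.size = n}
        ((k + 1) * Nat.choose (k + 1) 3 + Nat.choose (k + 2) 3)) := by
  refine ⟨?_, ?_⟩
  · rintro k rfl
    constructor
    · obtain ⟨lam, h1, h2, h3, h4⟩ := motz_to_core (2 * k) hs _ (tent_motz (2 * k))
      refine ⟨lam, h1, h2, h3, ?_⟩
      rw [Q_tent_even] at h4
      omega
    · rintro n ⟨lam, h1, h2, h3, rfl⟩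
      obtain ⟨h, H, hQ⟩ := core_to_motz (2 * k) hs lam h1 h2 h3
      have := Q_le_even H
      omega
  · rintro k rfl
    constructor
    · obtain ⟨lam, h1, h2, h3, h4⟩ := motz_to_core (2 * k + 1) hs _ (tent_motz (2 * k + 1))
      refine ⟨lam, h1, h2, h3, ?_⟩
      rw [Q_tent_odd] at h4
      omega
    · rintro n ⟨lam, h1, h2, h3, rfl⟩
      obtain ⟨h, H, hQ⟩ := core_to_motz (2 * k + 1) hs lam h1 h2 h3
      have := Q_le_odd H
      omega
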